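/- arXiv:2010.04265 — 7 statements merged into one kernel-verified Lean document; each statement's English description precedes it below -/
import Mathlib

section
/- For every subset S of the real line there exists a strictly increasing function g : S → ℝ such that every gap of the image g(S) is an open interval. -/
/-- A lacuna of `S ⊆ ℝ`: a nondegenerate interval disjoint from `S` having a
lower bound in `S` and an upper bound in `S`. -/
def IsLacuna (S G : Set ℝ) : Prop :=
  G.OrdConnected ∧ G.Nontrivial ∧ Disjoint G S ∧
    (∃ s ∈ S, ∀ x ∈ G, s ≤ x) ∧ (∃ s ∈ S, ∀ x ∈ G, x ≤ s)

/-- A gap of `S ⊆ ℝ`: a maximal lacuna of `S`. -/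
def IsGap (S G : Set ℝ) : Prop :=
  IsLacuna S G ∧ ∀ G', IsLacuna S G' → G ⊆ G' → G' = G

/-- The points of `ℝ` which have no point of `S` on one side, or lie between two points of `S`
(possibly equal) enclosing no further point of `S`. -/
def jumpFilling (S : Set ℝ) : Set ℝ :=
  {z | (∃ s ∈ S, s ≤ z) → (∃ s ∈ S, z ≤ s) →
    ∃ x ∈ S, ∃ y ∈ S, x ≤ z ∧ z ≤ y ∧ ∀ w ∈ S, x < w → w < y → False}

theorem subset_jumpFilling (S : Set ℝ) : S ⊆ jumpFilling S :=
  fun z hz _ _ => ⟨z, hz, z, hz, le_rfl, le_rfl, fun _ _ h h' => lt_asymm h h'⟩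

theorem exists_lt_mem_jumpFilling (S : Set ℝ) (z : ℝ) : ∃ w ∈ jumpFilling S, w < z := by
  by_cases h : ∃ s ∈ S, s ≤ z - 1
  · obtain ⟨s, hs, hsz⟩ := h
    exact ⟨s, subset_jumpFilling S hs, by linarith⟩
  · exact ⟨z - 1, fun h' => absurd h' h, by linarith⟩

theorem exists_gt_mem_jumpFilling (S : Set ℝ) (z : ℝ) : ∃ w ∈ jumpFilling S, z < w := by
  by_cases h : ∃ s ∈ S, z + 1 ≤ s
  · obtain ⟨s, hs, hsz⟩ := h
    exact ⟨s, subset_jumpFilling S hs, by linarith⟩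
  · exact ⟨z + 1, fun _ h' => absurd h' h, by linarith⟩

theorem exists_between_mem_jumpFilling {S : Set ℝ} {x y : ℝ} (hx : x ∈ jumpFilling S)
    (hy : y ∈ jumpFilling S) (hxy : x < y) : ∃ w ∈ jumpFilling S, x < w ∧ w < y := by
  by_cases h : ∃ s ∈ S, x < s ∧ s < y
  · obtain ⟨s, hs, hsxy⟩ := h
    exact ⟨s, subset_jumpFilling S hs, hsxy⟩
  have hS : ∀ s ∈ S, s ≤ x ∨ y ≤ s := by
    intro s hs
    by_contra! hc
    exact h ⟨s, hs, hc⟩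
  refine ⟨(x + y) / 2, ?_, by linarith, by linarith⟩
  rintro ⟨s, hs, hsm⟩ ⟨t, ht, hmt⟩
  have hsx : s ≤ x := (hS s hs).resolve_right (by intro; linarith)
  have hyt : y ≤ t := (hS t ht).resolve_left (by intro; linarith)
  obtain ⟨a, ha, b, hb, hax, hxb, hab⟩ := hx ⟨s, hs, hsx⟩ ⟨t, ht, by linarith⟩
  obtain ⟨c, hc, d, hd, hcy, hyd, hcd⟩ := hy ⟨s, hs, by linarith⟩ ⟨t, ht, hyt⟩
  rcases hS b hb with hbx | hyb
  · rcases hS c hc with hcx | hyc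
    · exact ⟨c, hc, d, hd, by linarith, by linarith, hcd⟩
    · refine ⟨b, hb, c, hc, by linarith, by linarith, fun w hw h₁ h₂ => ?_⟩
      exact h ⟨w, hw, by linarith, by linarith⟩
  · exact ⟨a, ha, b, hb, by linarith, by linarith, hab⟩

/-- A densely ordered set of reals contains a countable set which is order-dense
in it. -/
theorem exists_countable_orderDense {L : Set ℝ}
    (hL : ∀ x ∈ L, ∀ y ∈ L, x < y → ∃ w ∈ L, x < w ∧ w < y) :
    ∃ D ⊆ L, D.Countable ∧ ∀ x ∈ L, ∀ y ∈ L, x < y → ∃ d ∈ D, x < d ∧ d < y := by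
  obtain ⟨D, hDc, hD⟩ := TopologicalSpace.exists_countable_dense L
  refine ⟨(↑) '' D, Subtype.coe_image_subset L D, hDc.image _, fun x hx y hy hxy => ?_⟩
  obtain ⟨w, hw, hxw, hwy⟩ := hL x hx y hy hxy
  obtain ⟨d, hd, hdD⟩ := hD.exists_mem_open
    ((isOpen_Ioo (a := x) (b := y)).preimage (continuous_subtype_val (p := (· ∈ L))))
    ⟨⟨w, hw⟩, hxw, hwy⟩
  exact ⟨d, ⟨d, hd, rfl⟩, hdD⟩

/-- An unbounded, densely ordered set of reals maps to `ℝ` monotonically so that a countable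
order-dense subset is identified with `ℚ`. -/
theorem exists_monotone_rat_coe_mem_image {L : Set ℝ}
    (hlt : ∀ z, ∃ w ∈ L, w < z) (hgt : ∀ z, ∃ w ∈ L, z < w)
    (hL : ∀ x ∈ L, ∀ y ∈ L, x < y → ∃ w ∈ L, x < w ∧ w < y) :
    ∃ g : ℝ → ℝ, StrictMonoOn g L ∧ ∀ q : ℚ, ∃ d ∈ L, g d = q := by
  obtain ⟨D, hDL, hDc, hD⟩ := exists_countable_orderDense hL
  have hDlt : ∀ x ∈ L, ∃ d ∈ D, d < x := fun x hx => by
    obtain ⟨w, hw, hwx⟩ := hlt x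
    obtain ⟨d, hd, -, hdx⟩ := hD w hw x hx hwx
    exact ⟨d, hd, hdx⟩
  have hDgt : ∀ x ∈ L, ∃ d ∈ D, x < d := fun x hx => by
    obtain ⟨w, hw, hxw⟩ := hgt x
    obtain ⟨d, hd, hxd, -⟩ := hD x hx w hw hxw
    exact ⟨d, hd, hxd⟩
  have : Countable D := hDc.to_subtype
  have : Nonempty D := by
    obtain ⟨x, hx, -⟩ := hlt 0
    obtain ⟨d, hd, -⟩ := hDlt x hx
    exact ⟨⟨d, hd⟩⟩
  have : DenselyOrdered D := ⟨fun a b hab => by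
    obtain ⟨d, hd, h₁, h₂⟩ := hD a (hDL a.2) b (hDL b.2) hab
    exact ⟨⟨d, hd⟩, h₁, h₂⟩⟩
  have : NoMinOrder D := ⟨fun a => by
    obtain ⟨d, hd, h⟩ := hDlt a (hDL a.2)
    exact ⟨⟨d, hd⟩, h⟩⟩
  have : NoMaxOrder D := ⟨fun a => by
    obtain ⟨d, hd, h⟩ := hDgt a (hDL a.2)
    exact ⟨⟨d, hd⟩, h⟩⟩
  obtain ⟨φ⟩ := Order.iso_of_countable_dense D ℚ
  let A : ℝ → Set ℝ := fun x => (fun d : D => (φ d : ℝ)) '' {d | (d : ℝ) ≤ x}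
  have hub : ∀ (x : ℝ) (d : D), x ≤ d → (φ d : ℝ) ∈ upperBounds (A x) := by
    rintro x d hxd _ ⟨e, he, rfl⟩
    have : e ≤ d := le_trans (α := ℝ) he hxd
    exact Rat.cast_le.2 (φ.monotone this)
  have hle : ∀ x ∈ L, ∀ d : D, (d : ℝ) ≤ x → (φ d : ℝ) ≤ sSup (A x) := fun x hx d hdx => by
    obtain ⟨e, he, hxe⟩ := hDgt x hx
    exact le_csSup ⟨_, hub x ⟨e, he⟩ hxe.le⟩ ⟨d, hdx, rfl⟩
  have hge : ∀ x ∈ L, ∀ d : D, x ≤ d → sSup (A x) ≤ (φ d : ℝ) := fun x hx d hxd => by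
    obtain ⟨e, he, hex⟩ := hDlt x hx
    exact csSup_le ⟨_, ⟨e, he⟩, hex.le, rfl⟩ (hub x d hxd)
  refine ⟨fun x => sSup (A x), fun x hx y hy hxy => ?_, fun q => ?_⟩
  · obtain ⟨d, hd, hxd, hdy⟩ := hD x hx y hy hxy
    obtain ⟨e, he, hde, hey⟩ := hD d (hDL hd) y hy hdy
    have hφ : φ ⟨d, hd⟩ < φ ⟨e, he⟩ := φ.strictMono hde
    calc sSup (A x) ≤ φ ⟨d, hd⟩ := hge x hx ⟨d, hd⟩ hxd.le
      _ < φ ⟨e, he⟩ := by exact_mod_cast hφ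
      _ ≤ sSup (A y) := hle y hy ⟨e, he⟩ hey.le
  · have hdL := hDL (φ.symm q).2
    refine ⟨φ.symm q, hdL, le_antisymm ?_ ?_⟩
    · simpa using hge _ hdL (φ.symm q) le_rfl
    · simpa using hle _ hdL (φ.symm q) le_rfl

/-- Debreu's Open Gap Lemma: for every `S ⊆ ℝ` there is a strictly increasing
function `g : S → ℝ` all of whose image's gaps are open intervals. -/
theorem debreu_open_gap_lemma (S : Set ℝ) :
    ∃ g : S → ℝ, StrictMono g ∧
      ∀ G : Set ℝ, IsGap (Set.range g) G → ∃ a b : ℝ, G = Set.Ioo a b := by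
  have hSL := subset_jumpFilling S
  obtain ⟨g, hg, hgq⟩ := exists_monotone_rat_coe_mem_image
    (exists_lt_mem_jumpFilling S) (exists_gt_mem_jumpFilling S)
    fun _ hx _ hy => exists_between_mem_jumpFilling hx hy
  refine ⟨fun x => g x, fun x y hxy => hg (hSL x.2) (hSL y.2) hxy, ?_⟩
  rintro G ⟨⟨hconn, hnt, hdisj, ⟨_, ⟨s, rfl⟩, hs⟩, ⟨_, ⟨t, rfl⟩, ht⟩⟩, hmax⟩
  have hGS : ∀ w ∈ S, g w ∉ G := fun w hw hwG => hdisj.notMem_of_mem_left hwG ⟨⟨w, hw⟩, rfl⟩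
  obtain ⟨u, hu, v, hv, huv⟩ := hnt.exists_lt
  obtain ⟨q, huq, hqv⟩ := exists_rat_btwn huv
  obtain ⟨d, hd, hdq⟩ := hgq q
  have hdG : g d ∈ G := hconn.out hu hv ⟨by rw [hdq]; exact huq.le, by rw [hdq]; exact hqv.le⟩
  obtain ⟨x, hx, y, hy, hxd, hdy, hxy⟩ := hd
    ⟨s, s.2, (hg.le_iff_le (hSL s.2) hd).1 (hs _ hdG)⟩
    ⟨t, t.2, (hg.le_iff_le hd (hSL t.2)).1 (ht _ hdG)⟩
  have hgx : g x ≤ g d := hg.monotoneOn (hSL hx) hd hxd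
  have hgy : g d ≤ g y := hg.monotoneOn hd (hSL hy) hdy
  have hsub : G ⊆ Set.Ioo (g x) (g y) := by
    intro z hz
    constructor
    · by_contra! h
      exact hGS x hx (hconn.out hz hdG ⟨h, hgx⟩)
    · by_contra! h
      exact hGS y hy (hconn.out hdG hz ⟨hgy, h⟩)
  refine ⟨g x, g y, (hmax _ ⟨Set.ordConnected_Ioo, hnt.mono hsub, ?_, ?_, ?_⟩ hsub).symm⟩
  · rw [Set.disjoint_left]
    rintro _ ⟨h₁, h₂⟩ ⟨w, rfl⟩
    exact hxy w w.2 ((hg.lt_iff_lt (hSL hx) (hSL w.2)).1 h₁)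
      ((hg.lt_iff_lt (hSL w.2) (hSL hy)).1 h₂)
  · exact ⟨g x, ⟨⟨x, hx⟩, rfl⟩, fun z hz => hz.1.le⟩
  · exact ⟨g y, ⟨⟨y, hy⟩, rfl⟩, fun z hz => hz.2.le⟩
end

section
/- Let (X,τ) be a topological space, let ≺ be a semiorder on X, and let u : X → ℝ be a continuous function such that x ≺ y ↔ u(x) + 1 < u(y) for all x,y ∈ X. Suppose a net f : ι → X (with filter F ≠ ⊥ on ι) converges along F to a point a ∈ X, and b, c ∈ X are such that f(i) ≺ b, b ≾ a, f(i) ≺ c, and c ≾ a for every i ∈ ι. Then b ∼⁰ c. -/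
open Filter Topology

/-- A semiorder: an asymmetric relation satisfying the two semiorder axioms. -/
def IsSemiorder {X : Type*} (r : X → X → Prop) : Prop :=
  (∀ x y, r x y → ¬ r y x) ∧
  (∀ x y z t, r x y → r z t → r x t ∨ r z y) ∧
  (∀ x y z w, r x y → r y z → r x w ∨ r w z)

/-- The main trace `≾⁰` of a relation. -/
def MainTrace {X : Type*} (r : X → X → Prop) (x y : X) : Prop :=
  ∀ z, (r z x → r z y) ∧ (r y z → r x z)

/-- The indifference `∼⁰` of the main trace. -/
def MainIndiff {X : Type*} (r : X → X → Prop) (x y : X) : Prop :=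
  MainTrace r x y ∧ MainTrace r y x

/-- If a net converges to `a`, and `b, c` satisfy `f i ≺ b ≾ a` and `f i ≺ c ≾ a`
for all `i`, then `b ∼⁰ c`.  (Here `x ≾ y` means `¬ (y ≺ x)`.) -/
theorem net_below_main_indiff {X : Type*} [TopologicalSpace X]
    (r : X → X → Prop) (hr : IsSemiorder r) (u : X → ℝ)
    (hu : Continuous u) (hrep : ∀ x y, r x y ↔ u x + 1 < u y)
    {ι : Type*} (F : Filter ι) (hF : F ≠ ⊥) (f : ι → X) (a b c : X)
    (ha : Tendsto f F (𝓝 a))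
    (hb : ∀ i, r (f i) b) (hba : ¬ r a b)
    (hc : ∀ i, r (f i) c) (hca : ¬ r a c) :
    MainIndiff r b c := by
  have : F.NeBot := ⟨hF⟩
  have key : ∀ d, (∀ i, r (f i) d) → ¬ r a d → u d = u a + 1 := fun d hd had =>
    le_antisymm (not_lt.1 (mt (hrep a d).2 had))
      (le_of_tendsto (((hu.tendsto a).comp ha).add_const 1)
        (Eventually.of_forall fun i => ((hrep (f i) d).1 (hd i)).le))
  have hbc : u b = u c := (key b hb hba).trans (key c hc hca).symm
  simp [MainIndiff, MainTrace, hrep, hbc]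
end

section
/- Let (X,τ) be a topological space, let ≺ be a semiorder on X, and let u : X → ℝ be a continuous function such that x ≺ y ↔ u(x) + 1 < u(y) for all x,y ∈ X. Suppose a net f : ι → X (with filter F ≠ ⊥ on ι) converges along F to a point a ∈ X, and b, c ∈ X are such that a ≾ b, b ≺ f(i), a ≾ c, and c ≺ f(i) for every i ∈ ι. Then b ∼⁰ c. -/
open Filter Topology

/-- If a net converges to `a`, and `b, c` satisfy `a ≾ b ≺ f i` and `a ≾ c ≺ f i`
for all `i`, then `b ∼⁰ c`.  (Here `x ≾ y` means `¬ (y ≺ x)`.) -/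
theorem net_above_main_indiff {X : Type*} [TopologicalSpace X]
    (r : X → X → Prop) (hr : IsSemiorder r) (u : X → ℝ)
    (hu : Continuous u) (hrep : ∀ x y, r x y ↔ u x + 1 < u y)
    {ι : Type*} (F : Filter ι) (hF : F ≠ ⊥) (f : ι → X) (a b c : X)
    (ha : Tendsto f F (𝓝 a))
    (hb : ∀ i, r b (f i)) (hab : ¬ r b a)
    (hc : ∀ i, r c (f i)) (hac : ¬ r c a) :
    MainIndiff r b c := by
  have : F.NeBot := ⟨hF⟩
  have eq_limit : ∀ x, (∀ i, r x (f i)) → ¬ r x a → u x + 1 = u a := fun x hx hxa =>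
    le_antisymm
      (ge_of_tendsto' ((hu.tendsto a).comp ha) fun i => ((hrep x (f i)).1 (hx i)).le)
      (not_lt.1 fun h => hxa ((hrep x a).2 h))
  have hbc : u b = u c := by linarith [eq_limit b hb hab, eq_limit c hc hac]
  simp [MainIndiff, MainTrace, hrep, hbc]
end

section
/- Let (X,τ) be a topological space endowed with a semiorder ≺, and assume τ is compatible with respect to the indifference of the main trace of ≺, i.e. whenever x ∼⁰ y, then x ∈ O ↔ y ∈ O for every open set O. If there is a continuous function u : X → ℝ with x ≺ y ↔ u(x) + 1 < u(y) for all x,y ∈ X, then the main trace ≾⁰ is τ-continuous: for every x ∈ X the sets {y ∈ X | x ≺⁰ y} and {y ∈ X | y ≺⁰ x} are open, where ≺⁰ is the strict part of ≾⁰. -/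
/-- The strict part `≺⁰` of the main trace. -/
def MainTraceStrict {X : Type*} (r : X → X → Prop) (x y : X) : Prop :=
  MainTrace r x y ∧ ¬ MainTrace r y x

/-- An SS-representation is monotone for the main trace. -/
theorem mainTrace_of_le {X : Type*} {r : X → X → Prop} {u : X → ℝ}
    (hrep : ∀ x y, r x y ↔ u x + 1 < u y) {x y : X} (h : u x ≤ u y) : MainTrace r x y := by
  intro z
  simp only [hrep]
  constructor <;> intro _ <;> linarith

/-- When the topology does not separate points that are indifferent for the main trace, a continuous
SS-representation is a utility function for the main trace. -/
theorem mainTraceStrict_iff_lt {X : Type*} [TopologicalSpace X] {r : X → X → Prop}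
    (hcompat : ∀ x y, MainIndiff r x y → ∀ O : Set X, IsOpen O → (x ∈ O ↔ y ∈ O))
    {u : X → ℝ} (hu : Continuous u) (hrep : ∀ x y, r x y ↔ u x + 1 < u y) (x y : X) :
    MainTraceStrict r x y ↔ u x < u y := by
  refine ⟨fun h => not_le.mp fun hle => h.2 (mainTrace_of_le hrep hle), fun h => ?_⟩
  have hxy := mainTrace_of_le hrep h.le
  refine ⟨hxy, fun hyx => ?_⟩
  have hmem := hcompat x y ⟨hxy, hyx⟩ {w | u x < u w} (isOpen_lt continuous_const hu)
  exact lt_irrefl (u x) (hmem.mpr h)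

/-- If the topology is compatible with the indifference of the main trace and the
semiorder has a continuous SS-representation, then the main trace is `τ`-continuous. -/
theorem main_trace_continuous {X : Type*} [TopologicalSpace X]
    (r : X → X → Prop) (hr : IsSemiorder r)
    (hcompat : ∀ x y, MainIndiff r x y → ∀ O : Set X, IsOpen O → (x ∈ O ↔ y ∈ O))
    (u : X → ℝ) (hu : Continuous u) (hrep : ∀ x y, r x y ↔ u x + 1 < u y) :
    ∀ x : X, IsOpen {y : X | MainTraceStrict r x y} ∧
      IsOpen {y : X | MainTraceStrict r y x} := by
  intro x
  simp only [mainTraceStrict_iff_lt hcompat hu hrep]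
  exact ⟨isOpen_lt continuous_const hu, isOpen_lt hu continuous_const⟩
end

section
/- Let ≺ be a bounded semiorder on a set X and let u : X → ℝ be an SS-representation of ≺. Then there is no sequence (G_n) of gaps of u(X) such that the length of G_n is strictly smaller than the length of G_{n+1} for every n; consequently, if u(X) has at least one gap, then there exists a gap of u(X) whose length is greater than or equal to the length of every gap of u(X). -/
/-- A semiorder is bounded if it admits no strictly increasing and no strictly
decreasing infinite sequence. -/
def BoundedSemiorder {X : Type*} (r : X → X → Prop) : Prop :=
  IsSemiorder r ∧ (¬ ∃ x : ℕ → X, ∀ n, r (x n) (x (n + 1))) ∧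
    (¬ ∃ x : ℕ → X, ∀ n, r (x (n + 1)) (x n))

/-- The length of a gap: its supremum minus its infimum. -/
noncomputable def gapLength (G : Set ℝ) : ℝ := sSup G - sInf G

/-- A serial relation on a nonempty type admits an infinite chain. -/
theorem exists_seq_rel_succ {α : Type*} [Nonempty α] {R : α → α → Prop}
    (h : ∀ a, ∃ b, R a b) : ∃ f : ℕ → α, ∀ n, R (f n) (f (n + 1)) := by
  choose g hg using h
  refine ⟨fun n => g^[n] (Classical.arbitrary α), fun n => ?_⟩
  simp only [Function.iterate_succ_apply']
  exact hg _

theorem BoundedSemiorder.bddAbove_range {X : Type*} {r : X → X → Prop}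
    (hr : BoundedSemiorder r) {u : X → ℝ} (hrep : ∀ x y, r x y ↔ u x + 1 < u y) :
    BddAbove (Set.range u) := by
  by_contra hb
  rw [not_bddAbove_iff] at hb
  have : Nonempty X := by
    obtain ⟨_, ⟨x, rfl⟩, -⟩ := hb 0
    exact ⟨x⟩
  refine hr.2.1 (exists_seq_rel_succ fun x => ?_)
  obtain ⟨_, ⟨y, rfl⟩, hy⟩ := hb (u x + 1)
  exact ⟨y, (hrep x y).2 hy⟩

theorem BoundedSemiorder.bddBelow_range {X : Type*} {r : X → X → Prop}
    (hr : BoundedSemiorder r) {u : X → ℝ} (hrep : ∀ x y, r x y ↔ u x + 1 < u y) :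
    BddBelow (Set.range u) := by
  by_contra hb
  rw [not_bddBelow_iff] at hb
  have : Nonempty X := by
    obtain ⟨_, ⟨x, rfl⟩, -⟩ := hb 0
    exact ⟨x⟩
  refine hr.2.2 (exists_seq_rel_succ (R := fun x y => r y x) fun x => ?_)
  obtain ⟨_, ⟨y, rfl⟩, hy⟩ := hb (u x - 1)
  exact ⟨y, (hrep y x).2 (by linarith)⟩

theorem IsLacuna.nonempty {S G : Set ℝ} (h : IsLacuna S G) : G.Nonempty :=
  h.2.1.nonempty

theorem IsLacuna.bddBelow {S G : Set ℝ} (h : IsLacuna S G) : BddBelow G := by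
  obtain ⟨-, -, -, ⟨s, -, hs⟩, -⟩ := h
  exact ⟨s, hs⟩

theorem IsLacuna.bddAbove {S G : Set ℝ} (h : IsLacuna S G) : BddAbove G := by
  obtain ⟨-, -, -, -, s, -, hs⟩ := h
  exact ⟨s, hs⟩

theorem IsLacuna.gapLength_pos {S G : Set ℝ} (h : IsLacuna S G) : 0 < gapLength G := by
  obtain ⟨a, ha, b, hb, hab⟩ := h.2.1.exists_lt
  have h₁ := csInf_le h.bddBelow ha
  have h₂ := le_csSup h.bddAbove hb
  unfold gapLength
  linarith

theorem IsLacuna.union {S G G' : Set ℝ} (h : IsLacuna S G) (h' : IsLacuna S G')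
    (hne : (G ∩ G').Nonempty) : IsLacuna S (G ∪ G') := by
  obtain ⟨ho, hn, hd, ⟨a, ha, hal⟩, b, hb, hbu⟩ := h
  obtain ⟨ho', -, hd', ⟨a', ha', hal'⟩, b', hb', hbu'⟩ := h'
  refine ⟨?_, hn.mono Set.subset_union_left, hd.union_left hd', ⟨min a a', ?_, ?_⟩,
    max b b', ?_, ?_⟩
  · exact (ho.isPreconnected.union' hne ho'.isPreconnected).ordConnected
  · rcases min_choice a a' with h | h <;> rw [h] <;> assumption
  · rintro x (hx | hx)
    exacts [min_le_of_left_le (hal x hx), min_le_of_right_le (hal' x hx)]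
  · rcases max_choice b b' with h | h <;> rw [h] <;> assumption
  · rintro x (hx | hx)
    exacts [le_max_of_le_left (hbu x hx), le_max_of_le_right (hbu' x hx)]

theorem IsGap.disjoint {S G G' : Set ℝ} (h : IsGap S G) (h' : IsGap S G') (hne : G ≠ G') :
    Disjoint G G' := by
  by_contra hd
  have hU := h.1.union h'.1 (Set.not_disjoint_iff_nonempty_inter.1 hd)
  exact hne ((h.2 _ hU Set.subset_union_left).symm.trans (h'.2 _ hU Set.subset_union_right))

/-- The infima of two distinct gaps are at least as far apart as the shorter gap is long. -/
theorem IsGap.min_gapLength_le_dist_sInf {S G G' : Set ℝ} (h : IsGap S G) (h' : IsGap S G')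
    (hne : G ≠ G') : min (gapLength G) (gapLength G') ≤ dist (sInf G) (sInf G') := by
  have key : ∀ {A B : Set ℝ}, IsGap S A → IsGap S B → A ≠ B → sInf A ≤ sInf B →
      gapLength A ≤ sInf B - sInf A := by
    intro A B hA hB hAB hle
    have hd := hA.disjoint hB hAB
    have hord : ∀ x ∈ A, ∀ y ∈ B, x ≤ y := by
      intro x hx y hy
      by_contra! hyx
      have hyA : ∀ z ∈ A, y < z := fun z hz => by
        by_contra! hzy
        exact Set.disjoint_left.1 hd (hA.1.1.out hz hx ⟨hzy, hyx.le⟩) hy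
      have hBx : ∃ z ∈ B, z ≠ y := hB.1.2.1.exists_ne y
      have h₁ : y ≤ sInf A := le_csInf hA.1.nonempty fun z hz => (hyA z hz).le
      have hBy : ∀ z ∈ B, y ≤ z := fun z hz => (h₁.trans hle).trans (csInf_le hB.1.bddBelow hz)
      obtain ⟨z, hz, hzy⟩ := hBx
      have hyz : y < z := lt_of_le_of_ne (hBy z hz) hzy.symm
      have h₂ : sInf A < z := by
        have := csInf_le hB.1.bddBelow hy
        linarith
      obtain ⟨w, hw, hwz⟩ := exists_lt_of_csInf_lt hA.1.nonempty h₂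
      exact Set.disjoint_left.1 hd hw (hB.1.1.out hy hz ⟨(hyA w hw).le, hwz.le⟩)
    have : sSup A ≤ sInf B := csSup_le hA.1.nonempty fun x hx =>
      le_csInf hB.1.nonempty fun y hy => hord x hx y hy
    unfold gapLength
    linarith
  rcases le_total (sInf G) (sInf G') with hle | hle
  · rw [dist_comm, Real.dist_eq]
    exact (min_le_left _ _).trans ((key h h' hne hle).trans (le_abs_self _))
  · rw [Real.dist_eq]
    exact (min_le_right _ _).trans ((key h' h hne.symm hle).trans (le_abs_self _))

/-- A bounded set of reals has no sequence of gaps of strictly increasing lengths. -/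
theorem not_exists_gap_seq_gapLength_lt {S : Set ℝ} (hb : BddBelow S) (hB : BddAbove S) :
    ¬ ∃ G : ℕ → Set ℝ, (∀ n, IsGap S (G n)) ∧
      ∀ n, gapLength (G n) < gapLength (G (n + 1)) := by
  rintro ⟨G, hG, hlt⟩
  have hmono : StrictMono fun n => gapLength (G n) := strictMono_nat_of_lt_succ hlt
  obtain ⟨a, ha⟩ := hb
  obtain ⟨b, hb⟩ := hB
  have hmem : ∀ n, sInf (G n) ∈ Set.Icc a b := by
    intro n
    obtain ⟨-, -, -, ⟨s, hs, hsl⟩, t, ht, htu⟩ := (hG n).1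
    obtain ⟨x, hx⟩ := (hG n).1.nonempty
    exact ⟨le_csInf ⟨x, hx⟩ fun y hy => (ha hs).trans (hsl y hy),
      (csInf_le (hG n).1.bddBelow hx).trans ((htu x hx).trans (hb ht))⟩
  obtain ⟨c, -, φ, hφ, hc⟩ := isCompact_Icc.tendsto_subseq hmem
  obtain ⟨N, hN⟩ := Metric.cauchySeq_iff.1 hc.cauchySeq _ (hG 0).1.gapLength_pos
  have hclose := hN N le_rfl (N + 1) N.le_succ
  have hne : G (φ N) ≠ G (φ (N + 1)) := fun h =>
    (hmono (hφ N.lt_succ_self)).ne (congrArg gapLength h)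
  have hfar := (hG (φ N)).min_gapLength_le_dist_sInf (hG (φ (N + 1))) hne
  exact absurd hclose (not_lt.2 ((le_min (hmono.monotone (Nat.zero_le _))
    (hmono.monotone (Nat.zero_le _))).trans hfar))

/-- For an SS-representation of a bounded semiorder, there is no sequence of gaps
with strictly increasing lengths; consequently, if there is a gap at all, then
there is a gap of maximal length. -/
theorem bounded_semiorder_maximal_gap {X : Type*}
    (r : X → X → Prop) (hr : BoundedSemiorder r)
    (u : X → ℝ) (hrep : ∀ x y, r x y ↔ u x + 1 < u y) :
    (¬ ∃ G : ℕ → Set ℝ, (∀ n, IsGap (Set.range u) (G n)) ∧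
      (∀ n, gapLength (G n) < gapLength (G (n + 1)))) ∧
    ((∃ G, IsGap (Set.range u) G) →
      ∃ G, IsGap (Set.range u) G ∧
        ∀ G', IsGap (Set.range u) G' → gapLength G' ≤ gapLength G) := by
  have hseq := not_exists_gap_seq_gapLength_lt (hr.bddBelow_range hrep) (hr.bddAbove_range hrep)
  refine ⟨hseq, fun ⟨G₀, hG₀⟩ => ?_⟩
  by_contra! hmax
  have : Nonempty {G // IsGap (Set.range u) G} := ⟨⟨G₀, hG₀⟩⟩
  obtain ⟨f, hf⟩ := exists_seq_rel_succ
    (R := fun G G' : {G // IsGap (Set.range u) G} => gapLength G.1 < gapLength G'.1)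
    fun G => by
      obtain ⟨G', hG', hlt⟩ := hmax G.1 G.2
      exact ⟨⟨G', hG'⟩, hlt⟩
  exact hseq ⟨fun n => (f n).1, fun n => (f n).2, hf⟩
end

section
/- Let ≺ be a semiorder on a set X and let X₁, X₂ be disjoint nonempty subsets with X₁ ∪ X₂ = X such that x₁ ≺ x₂ for every x₁ ∈ X₁ and x₂ ∈ X₂. Let u₁, u₂ : X → ℝ satisfy: for all x, y ∈ X₁, x ≺ y ↔ u₁(x) + 1 < u₁(y); for all x, y ∈ X₂, x ≺ y ↔ u₂(x) + 1 < u₂(y); assume u₁(X₁) is bounded above and u₂(X₂) is bounded below. Set m := sSup u₁(X₁) − sInf u₂(X₂) + 2 and define u(x) := u₁(x) for x ∈ X₁ and u(x) := u₂(x) + m for x ∈ X₂. Then u is an SS-representation of ≺ on X, i.e. x ≺ y ↔ u(x) + 1 < u(y) for all x, y ∈ X. -/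
/-- Gluing SS-representations of the two components of a non-irreducible
semiorder yields an SS-representation of the whole semiorder. -/
theorem glue_ss_representation {X : Type*}
    (r : X → X → Prop) (hr : IsSemiorder r)
    (X₁ X₂ : Set X) (hdisj : Disjoint X₁ X₂) (h₁ : X₁.Nonempty) (h₂ : X₂.Nonempty)
    (hunion : X₁ ∪ X₂ = Set.univ)
    (hord : ∀ x₁ ∈ X₁, ∀ x₂ ∈ X₂, r x₁ x₂)
    (u₁ u₂ : X → ℝ)
    (hrep₁ : ∀ x ∈ X₁, ∀ y ∈ X₁, (r x y ↔ u₁ x + 1 < u₁ y))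
    (hrep₂ : ∀ x ∈ X₂, ∀ y ∈ X₂, (r x y ↔ u₂ x + 1 < u₂ y))
    (hbdd₁ : BddAbove (u₁ '' X₁)) (hbdd₂ : BddBelow (u₂ '' X₂))
    (m : ℝ) (hm : m = sSup (u₁ '' X₁) - sInf (u₂ '' X₂) + 2)
    (u : X → ℝ)
    (hu₁ : ∀ x ∈ X₁, u x = u₁ x) (hu₂ : ∀ x ∈ X₂, u x = u₂ x + m) :
    ∀ x y, r x y ↔ u x + 1 < u y := by
  have hcross : ∀ x ∈ X₁, ∀ y ∈ X₂, u x + 2 ≤ u y := by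
    intro x hx y hy
    have hsup := le_csSup hbdd₁ (Set.mem_image_of_mem u₁ hx)
    have hinf := csInf_le hbdd₂ (Set.mem_image_of_mem u₂ hy)
    rw [hu₁ x hx, hu₂ y hy, hm]
    linarith
  intro x y
  have hx : x ∈ X₁ ∪ X₂ := hunion ▸ Set.mem_univ x
  have hy : y ∈ X₁ ∪ X₂ := hunion ▸ Set.mem_univ y
  rcases hx with hx | hx <;> rcases hy with hy | hy
  · rw [hu₁ x hx, hu₁ y hy]
    exact hrep₁ x hx y hy
  · exact iff_of_true (hord x hx y hy) (by linarith [hcross x hx y hy])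
  · exact iff_of_false (hr.1 y x (hord y hy x hx)) (by linarith [hcross y hy x hx])
  · rw [hu₂ x hx, hu₂ y hy, hrep₂ x hx y hy, add_right_comm, add_lt_add_iff_right]
end

section
/- Let ≺ be a semiorder on a topological space (X,τ) and let X₁, X₂ be disjoint nonempty open subsets with X₁ ∪ X₂ = X such that x₁ ≺ x₂ for every x₁ ∈ X₁ and x₂ ∈ X₂. Let u₁, u₂ : X → ℝ be continuous on X₁ and on X₂ respectively and satisfy: for all x, y ∈ X₁, x ≺ y ↔ u₁(x) + 1 < u₁(y); for all x, y ∈ X₂, x ≺ y ↔ u₂(x) + 1 < u₂(y); assume u₁(X₁) is bounded above and u₂(X₂) is bounded below. Set m := sSup u₁(X₁) − sInf u₂(X₂) + 2 and define u(x) := u₁(x) for x ∈ X₁ and u(x) := u₂(x) + m for x ∈ X₂. Then u is a continuous SS-representation of ≺ on X. -/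
/-- Gluing continuous SS-representations of the two open components of a
non-irreducible semiorder yields a continuous SS-representation of the whole
semiorder. -/
theorem glue_continuous_ss_representation {X : Type*} [TopologicalSpace X]
    (r : X → X → Prop) (hr : IsSemiorder r)
    (X₁ X₂ : Set X) (hdisj : Disjoint X₁ X₂) (h₁ : X₁.Nonempty) (h₂ : X₂.Nonempty)
    (hopen₁ : IsOpen X₁) (hopen₂ : IsOpen X₂)
    (hunion : X₁ ∪ X₂ = Set.univ)
    (hord : ∀ x₁ ∈ X₁, ∀ x₂ ∈ X₂, r x₁ x₂)
    (u₁ u₂ : X → ℝ)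
    (hcont₁ : ContinuousOn u₁ X₁) (hcont₂ : ContinuousOn u₂ X₂)
    (hrep₁ : ∀ x ∈ X₁, ∀ y ∈ X₁, (r x y ↔ u₁ x + 1 < u₁ y))
    (hrep₂ : ∀ x ∈ X₂, ∀ y ∈ X₂, (r x y ↔ u₂ x + 1 < u₂ y))
    (hbdd₁ : BddAbove (u₁ '' X₁)) (hbdd₂ : BddBelow (u₂ '' X₂))
    (m : ℝ) (hm : m = sSup (u₁ '' X₁) - sInf (u₂ '' X₂) + 2)
    (u : X → ℝ)
    (hu₁ : ∀ x ∈ X₁, u x = u₁ x) (hu₂ : ∀ x ∈ X₂, u x = u₂ x + m) :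
    Continuous u ∧ ∀ x y, r x y ↔ u x + 1 < u y := by
  have hcov (x : X) : x ∈ X₁ ∨ x ∈ X₂ := hunion.ge (Set.mem_univ x)
  have hgap (x) (hx : x ∈ X₁) (y) (hy : y ∈ X₂) : u x + 2 ≤ u y := by
    have hsup := le_csSup hbdd₁ (Set.mem_image_of_mem u₁ hx)
    have hinf := csInf_le hbdd₂ (Set.mem_image_of_mem u₂ hy)
    rw [hu₁ x hx, hu₂ y hy]
    linarith
  refine ⟨?_, fun x y => ?_⟩
  · rw [← continuousOn_univ, ← hunion]
    exact (hcont₁.congr hu₁).union_of_isOpen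
      ((hcont₂.add continuousOn_const).congr hu₂) hopen₁ hopen₂
  · rcases hcov x with hx | hx <;> rcases hcov y with hy | hy
    · rw [hu₁ x hx, hu₁ y hy, hrep₁ x hx y hy]
    · exact iff_of_true (hord x hx y hy) (by linarith [hgap x hx y hy])
    · exact iff_of_false (hr.1 y x (hord y hy x hx)) (by linarith [hgap y hy x hx])
    · rw [hu₂ x hx, hu₂ y hy, hrep₂ x hx y hy, add_right_comm, add_lt_add_iff_right]
end
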